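/- arXiv:1210.2694 — 2 statements merged into one kernel-verified Lean document; each statement's English description precedes it below -/
import Mathlib

section
/- (Main Theorem) For every integer n ≥ 1, dim_ℝ K(2n−1) = n and dim_ℝ K(2n) = n + 1; equivalently, for every integer r ≥ 1, the degree-r homogeneous component of the colon ideal (J₁(r) ∩ J₂(r)) : ⟨y^{r+1}⟩ has ℝ-dimension ⌊r/2⌋ + 1. -/
open MvPolynomial

noncomputable section

/-- The polynomial ring `R = ℝ[x,y,z]`, with `x = X 0`, `y = X 1`, `z = X 2`. -/
abbrev R3 : Type := MvPolynomial (Fin 3) ℝ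

/-- `J₁(r) = ⟨x^{r+1}, (x+y)^{r+1}⟩`. -/
def J1 (r : ℕ) : Ideal R3 :=
  Ideal.span {(X 0 : R3) ^ (r + 1), ((X 0 : R3) + X 1) ^ (r + 1)}

/-- `J₂(r) = ⟨z^{r+1}, (z+y)^{r+1}⟩`. -/
def J2 (r : ℕ) : Ideal R3 :=
  Ideal.span {(X 2 : R3) ^ (r + 1), ((X 2 : R3) + X 1) ^ (r + 1)}

/-- `K(r)`: the ℝ-vector space of homogeneous polynomials `F` of degree `r` with
`y^{r+1}·F ∈ J₁(r) ∩ J₂(r)`, i.e. the degree-`r` homogeneous component of the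
colon ideal `(J₁(r) ∩ J₂(r)) : ⟨y^{r+1}⟩`. -/
def K (r : ℕ) : Submodule ℝ R3 :=
  (homogeneousSubmodule (Fin 3) ℝ r) ⊓
    (Submodule.comap (LinearMap.mulLeft ℝ ((X 1 : R3) ^ (r + 1)))
      ((J1 r ⊓ J2 r).restrictScalars ℝ))

section mat
open Matrix

lemma low_iff {n : ℕ} (A : Matrix (Fin n) (Fin n) ℝ) :
    A.BlockTriangular (OrderDual.toDual : Fin n → (Fin n)ᵒᵈ) ↔ ∀ m l, m < l → A m l = 0 := by
  constructor
  · intro h m l hml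
    exact h (OrderDual.toDual_lt_toDual.2 hml)
  · intro h m l hml
    exact h _ _ (OrderDual.toDual_lt_toDual.1 hml)

lemma exists_ldl {n : ℕ} (G : Matrix (Fin n) (Fin n) ℝ) (hG : G.PosDef) :
    ∃ (M : Matrix (Fin n) (Fin n) ℝ) (d : Fin n → ℝ),
      (∀ m l, m < l → M m l = 0) ∧ IsUnit M.det ∧ (∀ i, d i ≠ 0) ∧
      M * G * Mᵀ = diagonal d := by
  have h := LDL.diag_eq_lowerInv_conj hG
  have hu : IsUnit (LDL.lowerInv hG).det := by
    rw [← Matrix.isUnit_iff_isUnit_det]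
    exact isUnit_of_invertible _
  refine ⟨LDL.lowerInv hG, LDL.diagEntries hG, fun m l hml => LDL.lowerInv_triangular hG hml,
    hu, ?_, ?_⟩
  · have h2 : (diagonal (LDL.diagEntries hG)).det ≠ 0 := by
      have : diagonal (LDL.diagEntries hG) = LDL.diag hG := rfl
      rw [this, h, conjTranspose_eq_transpose_of_trivial, det_mul, det_mul, det_transpose]
      exact mul_ne_zero (mul_ne_zero hu.ne_zero hG.det_pos.ne') hu.ne_zero
    rw [det_diagonal, Finset.prod_ne_zero_iff] at h2
    exact fun i => h2 i (Finset.mem_univ _)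
  · rw [← conjTranspose_eq_transpose_of_trivial, ← h]; rfl

variable {n : ℕ} {G M : Matrix (Fin n) (Fin n) ℝ} {d : Fin n → ℝ}

lemma step1 (hM : ∀ m l, m < l → M m l = 0) (hu : IsUnit M.det) (hd : ∀ i, d i ≠ 0)
    (h : M * G * Mᵀ = diagonal d) (E : Matrix (Fin n) (Fin n) ℝ) :
    (∀ m l, m < l → (G * (Mᵀ * E * M)) m l = 0) ↔ (∀ m l, m < l → E m l = 0) := by
  have hI : Invertible M := Matrix.invertibleOfIsUnitDet M hu
  have hMt := (low_iff M).2 hM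
  have hMi := Matrix.blockTriangular_inv_of_blockTriangular hMt
  have e1 : G * (Mᵀ * E * M) = M⁻¹ * (diagonal d * E) * M := by
    rw [← h]
    simp only [← Matrix.mul_assoc]
    rw [Matrix.nonsing_inv_mul _ hu, Matrix.one_mul]
  constructor
  · intro hh
    have h1 := (hMt.mul ((low_iff _).2 hh)).mul hMi
    have e2 : M * (G * (Mᵀ * E * M)) * M⁻¹ = diagonal d * E := by
      rw [e1]
      simp only [← Matrix.mul_assoc]
      rw [Matrix.mul_nonsing_inv _ hu, Matrix.one_mul, Matrix.mul_assoc,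
        Matrix.mul_nonsing_inv _ hu, Matrix.mul_one]
    rw [e2] at h1
    intro m l hml
    have := (low_iff _).1 h1 m l hml
    rw [diagonal_mul] at this
    exact (mul_eq_zero.1 this).resolve_left (hd m)
  · intro hh
    rw [e1]
    exact (low_iff _).1 ((hMi.mul (((blockTriangular_diagonal d)).mul ((low_iff _).2 hh))).mul hMt)

lemma key (hM : ∀ m l, m < l → M m l = 0) (hu : IsUnit M.det) (hd : ∀ i, d i ≠ 0)
    (h : M * G * Mᵀ = diagonal d) (F : Matrix (Fin n) (Fin n) ℝ) :
    ((∀ m l, m < l → (G * F) m l = 0) ∧ (∀ m l, m < l → (G * Fᵀ) m l = 0)) ↔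
      ∃ δ, F = Mᵀ * diagonal δ * M := by
  constructor
  · rintro ⟨h1, h2⟩
    set E := Mᵀ⁻¹ * F * M⁻¹ with hE
    have hut : IsUnit Mᵀ.det := by rwa [det_transpose]
    have hF : F = Mᵀ * E * M := by
      rw [hE]
      simp only [← Matrix.mul_assoc]
      rw [Matrix.mul_nonsing_inv _ hut, Matrix.one_mul, Matrix.mul_assoc,
        Matrix.nonsing_inv_mul _ hu, Matrix.mul_one]
    have hFt : Fᵀ = Mᵀ * Eᵀ * M := by
      conv_lhs => rw [hF]
      simp [Matrix.transpose_mul, Matrix.mul_assoc]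
    rw [hF, step1 hM hu hd h] at h1
    rw [hFt, step1 hM hu hd h] at h2
    refine ⟨fun i => E i i, ?_⟩
    rw [hF]
    congr 2
    ext i j
    rcases lt_trichotomy i j with hij | rfl | hij
    · rw [h1 _ _ hij, diagonal_apply_ne _ hij.ne]
    · simp
    · rw [diagonal_apply_ne _ hij.ne']; exact h2 _ _ hij
  · rintro ⟨δ, rfl⟩
    have : (Mᵀ * diagonal δ * M)ᵀ = Mᵀ * diagonal δ * M := by
      simp [Matrix.transpose_mul, Matrix.mul_assoc]
    rw [this, step1 hM hu hd h]
    exact ⟨fun m l hml => diagonal_apply_ne _ hml.ne, fun m l hml => diagonal_apply_ne _ hml.ne⟩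

lemma conj_apply (δ : Fin n → ℝ) (i l : Fin n) :
    (Mᵀ * diagonal δ * M) i l = ∑ k, M k i * δ k * M k l := by
  rw [Matrix.mul_apply]
  simp [mul_diagonal]

lemma anti {r : ℕ} {M : Matrix (Fin (r+1)) (Fin (r+1)) ℝ}
    (hM : ∀ m l, m < l → M m l = 0) (hu : IsUnit M.det) (δ : Fin (r+1) → ℝ) :
    (∀ i l : Fin (r+1), r < (i : ℕ) + l → (Mᵀ * diagonal δ * M) i l = 0) ↔
      ∀ j : Fin (r+1), r < 2 * (j : ℕ) → δ j = 0 := by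
  have hdiag : ∀ i, M i i ≠ 0 := by
    have h2 := hu.ne_zero
    rw [det_of_isLowerTriangular _ ((low_iff _).2 hM), Finset.prod_ne_zero_iff] at h2
    exact fun i => h2 i (Finset.mem_univ _)
  constructor
  · intro h j
    induction j using WellFoundedGT.induction with
    | ind j ih =>
      intro hj
      have h1 := h j j (by omega)
      rw [conj_apply, Finset.sum_eq_single j] at h1
      · simpa [hdiag j] using h1
      · intro k _ hk
        rcases lt_or_gt_of_ne hk with hk | hk
        · rw [hM _ _ hk]; simp
        · rw [ih k hk (by have : (j:ℕ) < k := hk; omega)]; simp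
      · simp
  · intro h i l hil
    rw [conj_apply]
    refine Finset.sum_eq_zero fun k _ => ?_
    by_cases hk : r < 2 * (k : ℕ)
    · rw [h k hk]; simp
    · by_cases hki : k < i
      · rw [hM _ _ hki]; simp
      · have : k < l := by
          rw [Fin.lt_def] at *
          omega
        rw [hM _ _ this]; simp

/-- Gram matrix. -/
noncomputable def Gm (r : ℕ) : Matrix (Fin (r+1)) (Fin (r+1)) ℝ :=
  fun m i => (-1) ^ ((m : ℕ) + i) * ((2 * r - i - m).choose (r - m) : ℕ)

/-- The (signed) Pascal factor of the Gram matrix. -/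
noncomputable def Um (r : ℕ) : Matrix (Fin (r+1)) (Fin (r+1)) ℝ :=
  fun j i => (-1) ^ (i : ℕ) * ((r - i).choose (r - j) : ℕ)

lemma Gm_eq (r : ℕ) : Gm r = (Um r)ᵀ * Um r := by
  ext m i
  rw [Matrix.mul_apply]
  simp only [Gm, Um, transpose_apply]
  have hm := m.2
  have hi := i.2
  have e : 2 * r - (i : ℕ) - m = (r - m) + (r - i) := by omega
  have h1 : ∀ j : Fin (r+1), ((-1:ℝ) ^ (m : ℕ) * ((r - m).choose (r - j) : ℕ)) *
      ((-1) ^ (i : ℕ) * ((r - i).choose (r - j) : ℕ)) = (-1) ^ ((m : ℕ) + i) *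
      ((((r - m).choose (r - j) * (r - i).choose (r - j) : ℕ)) : ℝ) := by
    intro j; push_cast; ring
  rw [Finset.sum_congr rfl (fun j _ => h1 j), ← Finset.mul_sum, ← Nat.cast_sum]
  congr 2
  rw [e, Nat.add_choose_eq, Finset.Nat.sum_antidiagonal_eq_sum_range_succ_mk]
  rw [Fin.sum_univ_eq_sum_range (fun j => (r - (m:ℕ)).choose (r - j) * (r - (i:ℕ)).choose (r - j))]
  symm
  rw [← Finset.sum_range_reflect]
  have : ∀ j ∈ Finset.range (r+1), (r - (m:ℕ)).choose (r - (r + 1 - 1 - j)) *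
      (r - (i:ℕ)).choose (r - (r + 1 - 1 - j)) =
      (r - (m:ℕ)).choose j * (r - (i:ℕ)).choose j := by
    intro j hj
    rw [Finset.mem_range] at hj
    congr 2 <;> omega
  rw [Finset.sum_congr rfl this]
  have hs : Finset.range (r - (m:ℕ) + 1) ⊆ Finset.range (r+1) := by
    intro a; simp only [Finset.mem_range]; omega
  rw [← Finset.sum_subset hs, ← Finset.sum_range_reflect]
  · refine Finset.sum_congr rfl fun j hj => ?_
    rw [Finset.mem_range] at hj
    have e1 : r - (m:ℕ) + 1 - 1 - j = (r - m) - j := by omega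
    rw [e1, Nat.choose_symm (by omega)]
  · intro j _ hj
    rw [Finset.mem_range] at hj
    rw [Nat.choose_eq_zero_of_lt (by omega)]; simp

lemma Gm_posDef (r : ℕ) : (Gm r).PosDef := by
  rw [Gm_eq, ← conjTranspose_eq_transpose_of_trivial]
  apply Matrix.PosDef.conjTranspose_mul_self
  apply Matrix.mulVec_injective_of_isUnit
  rw [Matrix.isUnit_iff_isUnit_det]
  rw [det_of_isLowerTriangular]
  · rw [isUnit_iff_ne_zero, Finset.prod_ne_zero_iff]
    intro i _
    simp [Um]
  · rw [Matrix.IsLowerTriangular, low_iff]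
    intro j i hji
    have : (j : ℕ) < i := hji
    have := i.2
    simp only [Um]
    rw [Nat.choose_eq_zero_of_lt (by omega)]; simp

lemma Gm_symm (r : ℕ) : (Gm r)ᵀ = Gm r := by
  rw [Gm_eq]; simp [Matrix.transpose_mul]

end mat
/-- Exponent vector. -/
def mon (a b c : ℕ) : Fin 3 →₀ ℕ := Finsupp.equivFunOnFinite.symm ![a, b, c]

lemma mon_inj {a b c a' b' c' : ℕ} : mon a b c = mon a' b' c' ↔ a = a' ∧ b = b' ∧ c = c' := by
  simp [mon]

lemma mon_eta (m : Fin 3 →₀ ℕ) : mon (m 0) (m 1) (m 2) = m := by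
  ext i; fin_cases i <;> simp [mon]

lemma monomial_mon (a b c : ℕ) (t : ℝ) :
    monomial (mon a b c) t = C t * ((X 0 : R3) ^ a * X 1 ^ b * X 2 ^ c) := by
  rw [monomial_eq, Finsupp.prod_fintype _ _ (by simp)]
  simp [Fin.prod_univ_three, mon]

/-- Polynomial with coefficient matrix `A`. -/
def toP (r : ℕ) : Matrix (Fin (r+1)) (Fin (r+1)) ℝ →ₗ[ℝ] R3 where
  toFun A := ∑ i : Fin (r+1), ∑ l : Fin (r+1), monomial (mon i (r - i - l) l) (A i l)
  map_add' A B := by simp [Finset.sum_add_distrib]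
  map_smul' c A := by
    simp only [Finset.smul_sum, Matrix.smul_apply, RingHom.id_apply, smul_monomial]

lemma toP_apply (r : ℕ) (A) : toP r A = ∑ i : Fin (r+1), ∑ l : Fin (r+1), monomial (mon i (r - i - l) l) (A i l) := rfl

lemma coeff_toP (r : ℕ) (A) (i l : Fin (r+1)) :
    coeff (mon i (r - i - l) l) (toP r A) = A i l := by
  classical
  rw [toP_apply]
  simp only [coeff_sum, coeff_monomial, mon_inj]
  rw [Finset.sum_eq_single i, Finset.sum_eq_single l]
  · simp
  · intro k _ hk
    rw [if_neg]
    rintro ⟨-, -, h⟩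
    exact hk (Fin.ext h)
  · simp
  · intro k _ hk
    refine Finset.sum_eq_zero fun l _ => ?_
    rw [if_neg]
    rintro ⟨h, -⟩
    exact hk (Fin.ext h)
  · simp

lemma toP_inj (r : ℕ) : Function.Injective (toP r) := by
  intro A B h
  ext i l
  rw [← coeff_toP r A, h, coeff_toP]

lemma degree_mon (a b c : ℕ) : (mon a b c).degree = a + b + c := by
  rw [Finsupp.degree_eq_sum]
  simp [Fin.sum_univ_three, mon]

lemma toP_homog (r : ℕ) (A : Matrix (Fin (r+1)) (Fin (r+1)) ℝ)
    (hA : ∀ i l : Fin (r+1), r < (i : ℕ) + l → A i l = 0) : (toP r A).IsHomogeneous r := by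
  rw [toP_apply]
  refine IsHomogeneous.sum _ _ _ fun i _ => IsHomogeneous.sum _ _ _ fun l _ => ?_
  by_cases h : r < (i : ℕ) + l
  · rw [hA i l h, monomial_zero]; exact isHomogeneous_zero _ _ _
  · apply isHomogeneous_monomial
    rw [degree_mon]; omega

lemma exists_toP (r : ℕ) (F : R3) (hF : F.IsHomogeneous r) :
    ∃ A : Matrix (Fin (r+1)) (Fin (r+1)) ℝ,
      (∀ i l : Fin (r+1), r < (i : ℕ) + l → A i l = 0) ∧ toP r A = F := by
  classical
  refine ⟨fun i l => if r < (i:ℕ) + l then 0 else coeff (mon i (r - i - l) l) F, ?_, ?_⟩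
  · intro i l h
    exact if_pos h
  · set A : Matrix (Fin (r+1)) (Fin (r+1)) ℝ :=
      fun i l => if r < (i:ℕ) + l then 0 else coeff (mon i (r - i - l) l) F with hAd
    have hA : ∀ i l : Fin (r+1), r < (i : ℕ) + l → A i l = 0 := fun i l h => if_pos h
    have hom := toP_homog r A hA
    ext m
    by_cases hm : m.degree = r
    · have hm' : m 0 + m 1 + m 2 = r := by
        rw [← degree_mon, mon_eta, hm]
      have h1 := coeff_toP r A ⟨m 0, by omega⟩ ⟨m 2, by omega⟩
      have e : mon (m 0) (r - m 0 - m 2) (m 2) = m := by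
        rw [show r - m 0 - m 2 = m 1 by omega, mon_eta]
      simp only [e] at h1
      rw [h1, hAd]
      simp only
      rw [if_neg (by omega), e]
    · rw [hom.coeff_eq_zero hm, hF.coeff_eq_zero hm]

/-- The substitution `y ↦ y - x`. -/
def sg : R3 →ₐ[ℝ] R3 := aeval ![X 0, X 1 - X 0, X 2]
/-- The substitution `y ↦ x + y`. -/
def sgi : R3 →ₐ[ℝ] R3 := aeval ![X 0, X 0 + X 1, X 2]

lemma sg_sgi (F : R3) : sg (sgi F) = F := by
  have : sg.comp sgi = AlgHom.id ℝ R3 := by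
    ext i; fin_cases i <;> simp [sg, sgi]
  exact DFunLike.congr_fun this F

lemma sgi_sg (F : R3) : sgi (sg F) = F := by
  have : sgi.comp sg = AlgHom.id ℝ R3 := by
    ext i; fin_cases i <;> simp [sg, sgi]
  exact DFunLike.congr_fun this F

/-- The monomial ideal corresponding to `J1`. -/
def Jm (r : ℕ) : Ideal R3 := Ideal.span {(X 0 : R3) ^ (r + 1), (X 1 : R3) ^ (r + 1)}

lemma mem_J1_iff (r : ℕ) (F : R3) : F ∈ J1 r ↔ sg F ∈ Jm r := by
  constructor
  · intro h
    have h1 := Ideal.mem_map_of_mem sg h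
    rw [J1, Ideal.map_span] at h1
    rw [Jm]
    convert h1 using 2
    simp [Set.image_pair, sg]
  · intro h
    have h1 := Ideal.mem_map_of_mem sgi h
    rw [Jm, Ideal.map_span, sgi_sg] at h1
    rw [J1]
    convert h1 using 2
    simp [Set.image_pair, sgi]

lemma mem_Jm_iff (r : ℕ) (F : R3) :
    F ∈ Jm r ↔ ∀ a b c, a ≤ r → b ≤ r → coeff (mon a b c) F = 0 := by
  have : Jm r = Ideal.span ((fun s => (monomial s) (1:ℝ)) '' {mon (r+1) 0 0, mon 0 (r+1) 0}) := by
    rw [Jm, Set.image_pair]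
    simp [monomial_mon]
  rw [this, mem_ideal_span_monomial_image]
  constructor
  · intro h a b c ha hb
    by_contra hne
    obtain ⟨s, hs, hle⟩ := h _ (mem_support_iff.2 hne)
    rcases hs with rfl | rfl
    · have := hle 0
      simp [mon] at this; omega
    · have := hle 1
      simp [mon] at this; omega
  · intro h m hm
    by_contra hno
    push Not at hno
    refine (mem_support_iff.1 hm) ?_
    rw [← mon_eta m]
    apply h
    · by_contra hc
      refine hno (mon (r+1) 0 0) (by simp) ?_
      intro i
      fin_cases i <;> simp [mon]; omega
    · by_contra hc
      refine hno (mon 0 (r+1) 0) (by simp) ?_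
      intro i
      fin_cases i <;> simp [mon]; omega

lemma sub_pow_expand (n : ℕ) : ((X 1 : R3) - X 0) ^ n =
    ∑ b ∈ Finset.range (n+1), C ((-1) ^ (n - b) * (n.choose b : ℝ)) * (X 1 ^ b * X 0 ^ (n - b)) := by
  rw [sub_eq_add_neg, add_pow]
  refine Finset.sum_congr rfl fun b _ => ?_
  rw [neg_pow (X 0 : R3)]
  simp
  ring

lemma coeff_term (a b c i n l : ℕ) (t : ℝ) :
    coeff (mon a b c) (C t * ((X 0 : R3) ^ i * (X 1 - X 0) ^ n * X 2 ^ l)) =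
      if a + b = i + n ∧ c = l then t * ((-1) ^ (a + i) * (n.choose b : ℝ)) else 0 := by
  classical
  have h : C t * ((X 0 : R3) ^ i * (X 1 - X 0) ^ n * X 2 ^ l) =
      ∑ k ∈ Finset.range (n+1),
        monomial (mon (i + (n - k)) k l) (t * ((-1) ^ (n - k) * (n.choose k : ℝ))) := by
    rw [sub_pow_expand, Finset.mul_sum, Finset.sum_mul, Finset.mul_sum]
    refine Finset.sum_congr rfl fun k _ => ?_
    rw [monomial_mon, C_mul (a := t)]
    ring
  rw [h, coeff_sum]
  simp only [coeff_monomial, mon_inj]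
  split_ifs with hc
  · obtain ⟨h1, rfl⟩ := hc
    by_cases hb : b ≤ n
    · rw [Finset.sum_eq_single b]
      · rw [if_pos ⟨by omega, rfl, rfl⟩]
        have : a + i = (n - b) + 2 * i := by omega
        rw [this, pow_add, pow_mul]; simp
      · intro k _ hk
        rw [if_neg]; rintro ⟨-, h, -⟩; exact hk h
      · intro hk; simp at hk; omega
    · rw [Nat.choose_eq_zero_of_lt (by omega)]
      simp only [Nat.cast_zero, mul_zero]
      refine Finset.sum_eq_zero fun k hk => ?_
      rw [Finset.mem_range] at hk
      rw [if_neg]; rintro ⟨-, h, -⟩; omega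
  · refine Finset.sum_eq_zero fun k hk => ?_
    rw [Finset.mem_range] at hk
    rw [if_neg]; rintro ⟨h, h', h''⟩; exact hc ⟨by omega, h''.symm⟩

lemma sg_toP (r : ℕ) (A : Matrix (Fin (r+1)) (Fin (r+1)) ℝ) :
    sg (X 1 ^ (r+1) * toP r A) = ∑ i : Fin (r+1), ∑ l : Fin (r+1),
      C (A i l) * ((X 0 : R3) ^ (i:ℕ) * (X 1 - X 0) ^ (r + 1 + (r - i - l)) * X 2 ^ (l:ℕ)) := by
  rw [toP_apply, Finset.mul_sum, map_sum]
  refine Finset.sum_congr rfl fun i _ => ?_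
  rw [Finset.mul_sum, map_sum]
  refine Finset.sum_congr rfl fun l _ => ?_
  rw [monomial_mon]
  simp only [map_mul, map_pow]
  have h0 : sg (X 0) = X 0 := by simp [sg]
  have h1 : sg (X 1) = X 1 - X 0 := by simp [sg]
  have h2 : sg (X 2) = X 2 := by simp [sg]
  have hc : sg (C (A i l)) = C (A i l) := by simp [sg]
  rw [h0, h1, h2, hc, pow_add]
  ring

lemma coeff_sg_toP (r : ℕ) (A : Matrix (Fin (r+1)) (Fin (r+1)) ℝ)
    (hA : ∀ i l : Fin (r+1), r < (i : ℕ) + l → A i l = 0) (a b : ℕ) (l : Fin (r+1)) 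
    (hab : a + b + l = 2 * r + 1) :
    coeff (mon a b l) (sg (X 1 ^ (r+1) * toP r A)) =
      (-1) ^ a * ∑ i : Fin (r+1), (-1) ^ (i:ℕ) * A i l * ((2 * r + 1 - l - i).choose b : ℝ) := by
  rw [sg_toP]
  simp only [coeff_sum, coeff_term]
  rw [Finset.mul_sum]
  refine Finset.sum_congr rfl fun i _ => ?_
  rw [Finset.sum_eq_single l]
  · by_cases h : r < (i:ℕ) + l
    · rw [hA i l h]; simp
    · rw [if_pos ⟨by omega, rfl⟩]
      have : r + 1 + (r - (i:ℕ) - l) = 2 * r + 1 - l - i := by omega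
      rw [this, pow_add]; ring
  · intro k _ hk
    rw [if_neg]; rintro ⟨-, h⟩; exact hk (Fin.ext h.symm)
  · simp

lemma coeff_sg_toP_zero (r : ℕ) (A : Matrix (Fin (r+1)) (Fin (r+1)) ℝ)
    (hA : ∀ i l : Fin (r+1), r < (i : ℕ) + l → A i l = 0) (a b c : ℕ)
    (hab : ¬ (a + b + c = 2 * r + 1 ∧ c < r + 1)) :
    coeff (mon a b c) (sg (X 1 ^ (r+1) * toP r A)) = 0 := by
  rw [sg_toP]
  simp only [coeff_sum, coeff_term]
  refine Finset.sum_eq_zero fun i _ => Finset.sum_eq_zero fun l _ => ?_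
  by_cases h : r < (i:ℕ) + l
  · rw [hA i l h]; simp
  · rw [if_neg]; rintro ⟨h1, rfl⟩; exact hab ⟨by omega, l.2⟩

lemma mem_J1_toP (r : ℕ) (A : Matrix (Fin (r+1)) (Fin (r+1)) ℝ)
    (hA : ∀ i l : Fin (r+1), r < (i : ℕ) + l → A i l = 0) :
    X 1 ^ (r+1) * toP r A ∈ J1 r ↔ ∀ (l : Fin (r+1)) (b : ℕ), r + 1 ≤ b + l → b ≤ r →
      ∑ i : Fin (r+1), (-1) ^ (i:ℕ) * A i l * ((2 * r + 1 - l - i).choose b : ℝ) = 0 := by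
  rw [mem_J1_iff, mem_Jm_iff]
  constructor
  · intro h l b h1 h2
    have h3 := h (2 * r + 1 - l - b) b l (by omega) h2
    rw [coeff_sg_toP r A hA _ _ _ (by omega)] at h3
    simpa using h3
  · intro h a b c ha hb
    by_cases hc : a + b + c = 2 * r + 1 ∧ c < r + 1
    · have := coeff_sg_toP r A hA a b ⟨c, hc.2⟩ hc.1
      simp only at this
      rw [this, h ⟨c, hc.2⟩ b (by simp only; omega) hb, mul_zero]
    · exact coeff_sg_toP_zero r A hA a b c hc

/-- Vandermonde change of basis. -/
lemma vander (r : ℕ) (A : Matrix (Fin (r+1)) (Fin (r+1)) ℝ)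
    (hA : ∀ i l : Fin (r+1), r < (i : ℕ) + l → A i l = 0) (l : Fin (r+1)) (m : ℕ) (hm : m < l) :
    ∑ i : Fin (r+1), (-1) ^ (i:ℕ) * A i l * ((2 * r - i - m).choose (r - m) : ℝ) =
    ∑ t ∈ Finset.range (r - m + 1), ((l - 1 - m : ℕ).choose t : ℝ) * 
      ∑ i : Fin (r+1), (-1) ^ (i:ℕ) * A i l * ((2 * r + 1 - l - i).choose (r - m - t) : ℝ) := by
  simp_rw [Finset.mul_sum]
  rw [Finset.sum_comm]
  refine Finset.sum_congr rfl fun i _ => ?_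
  by_cases h : r < (i:ℕ) + l
  · rw [hA i l h]; simp
  · have e : 2 * r - (i:ℕ) - m = (l - 1 - m) + (2 * r + 1 - l - i) := by omega
    rw [e, Nat.add_choose_eq, Finset.Nat.sum_antidiagonal_eq_sum_range_succ_mk]
    push_cast
    rw [Finset.mul_sum]
    refine Finset.sum_congr rfl fun t _ => ?_
    ring

lemma cond_iff (r : ℕ) (A : Matrix (Fin (r+1)) (Fin (r+1)) ℝ)
    (hA : ∀ i l : Fin (r+1), r < (i : ℕ) + l → A i l = 0) :
    (∀ (l : Fin (r+1)) (b : ℕ), r + 1 ≤ b + l → b ≤ r →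
      ∑ i : Fin (r+1), (-1) ^ (i:ℕ) * A i l * ((2 * r + 1 - l - i).choose b : ℝ) = 0) ↔
    (∀ (l : Fin (r+1)) (m : ℕ), m < l →
      ∑ i : Fin (r+1), (-1) ^ (i:ℕ) * A i l * ((2 * r - i - m).choose (r - m) : ℝ) = 0) := by
  constructor
  · intro h l m hm
    rw [vander r A hA l m hm]
    refine Finset.sum_eq_zero fun t _ => ?_
    by_cases ht : t ≤ l - 1 - m
    · rw [h l (r - m - t) (by omega) (by omega), mul_zero]
    · rw [Nat.choose_eq_zero_of_lt (by omega)]; simp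
  · intro h l b
    induction b using Nat.strong_induction_on with
    | _ b ih =>
      intro h1 h2
      have h3 := h l (r - b) (by omega)
      rw [vander r A hA l (r - b) (by omega), Finset.sum_eq_single 0] at h3
      · rw [show r - (r - b) - 0 = b by omega] at h3
        simpa using h3
      · intro t _ ht0
        by_cases ht : t ≤ l - 1 - (r - b)
        · rw [ih (r - (r - b) - t) (by omega) (by omega) (by omega), mul_zero]
        · rw [Nat.choose_eq_zero_of_lt (by omega)]; simp
      · simp

/-- Exchange of `x` and `z`. -/
def sw : R3 →ₐ[ℝ] R3 := rename (Equiv.swap (0 : Fin 3) 2)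

lemma sw_sw (F : R3) : sw (sw F) = F := by
  have : sw.comp sw = AlgHom.id ℝ R3 := by
    ext i; fin_cases i <;> simp [sw]
  exact DFunLike.congr_fun this F

lemma sw0 : sw (X 0) = X 2 := by simp [sw]
lemma sw1 : sw (X 1) = X 1 := by
  simp only [sw, rename_X]
  rw [Equiv.swap_apply_of_ne_of_ne] <;> decide
lemma sw2 : sw (X 2) = X 0 := by simp [sw]

lemma mem_J2_iff (r : ℕ) (F : R3) : F ∈ J2 r ↔ sw F ∈ J1 r := by
  constructor
  · intro h
    have h1 := Ideal.mem_map_of_mem sw h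
    rw [J2, Ideal.map_span] at h1
    rw [J1]
    convert h1 using 2
    simp [Set.image_pair, sw1, sw2]
  · intro h
    have h1 := Ideal.mem_map_of_mem sw h
    rw [J1, Ideal.map_span, sw_sw] at h1
    rw [J2]
    convert h1 using 2
    simp [Set.image_pair, sw0, sw1]

lemma sw_toP (r : ℕ) (A : Matrix (Fin (r+1)) (Fin (r+1)) ℝ) :
    sw (toP r A) = toP r A.transpose := by
  rw [toP_apply, toP_apply, Finset.sum_comm, map_sum]
  refine Finset.sum_congr rfl fun i _ => ?_
  rw [map_sum]
  refine Finset.sum_congr rfl fun l _ => ?_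
  rw [monomial_mon, monomial_mon]
  simp only [map_mul, map_pow, sw0, sw1, sw2, Matrix.transpose_apply]
  have hc : sw (C (A l i)) = C (A l i) := by simp [sw]
  rw [hc, show r - (l:ℕ) - i = r - i - l by omega]
  ring

lemma mem_J1_G (r : ℕ) (A : Matrix (Fin (r+1)) (Fin (r+1)) ℝ)
    (hA : ∀ i l : Fin (r+1), r < (i : ℕ) + l → A i l = 0) :
    X 1 ^ (r+1) * toP r A ∈ J1 r ↔ ∀ m l : Fin (r+1), m < l → (Gm r * A) m l = 0 := by
  rw [mem_J1_toP r A hA, cond_iff r A hA]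
  have e : ∀ m l : Fin (r+1), (Gm r * A) m l = (-1) ^ (m:ℕ) *
      ∑ i : Fin (r+1), (-1) ^ (i:ℕ) * A i l * ((2 * r - i - m).choose (r - m) : ℝ) := by
    intro m l
    rw [Matrix.mul_apply, Finset.mul_sum]
    refine Finset.sum_congr rfl fun i _ => ?_
    simp only [Gm, pow_add]
    ring
  constructor
  · intro h m l hml
    rw [e, h l m hml, mul_zero]
  · intro h l m hml
    have := h ⟨m, by omega⟩ l hml
    rw [e] at this
    simpa using this

lemma mem_K_toP (r : ℕ) (A : Matrix (Fin (r+1)) (Fin (r+1)) ℝ)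
    (hA : ∀ i l : Fin (r+1), r < (i : ℕ) + l → A i l = 0) :
    toP r A ∈ K r ↔ (∀ m l : Fin (r+1), m < l → (Gm r * A) m l = 0) ∧
      (∀ m l : Fin (r+1), m < l → (Gm r * A.transpose) m l = 0) := by
  have hA' : ∀ i l : Fin (r+1), r < (i : ℕ) + l → A.transpose i l = 0 :=
    fun i l h => hA l i (by omega)
  rw [← mem_J1_G r A hA, ← mem_J1_G r _ hA', ← sw_toP]
  have e : X 1 ^ (r+1) * sw (toP r A) = sw (X 1 ^ (r+1) * toP r A) := by
    rw [map_mul, map_pow, sw1]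
  rw [e, ← mem_J2_iff]
  have hh : toP r A ∈ homogeneousSubmodule (Fin 3) ℝ r := toP_homog r A hA
  constructor
  · intro h
    exact h.2
  · intro h
    exact ⟨hh, h⟩

/-- Extension by zero, as a linear map. -/
def extz (r : ℕ) : (Fin (r / 2 + 1) → ℝ) →ₗ[ℝ] (Fin (r + 1) → ℝ) where
  toFun δ j := if h : (j : ℕ) < r / 2 + 1 then δ ⟨j, h⟩ else 0
  map_add' a b := by
    ext j
    by_cases h : (j : ℕ) < r / 2 + 1
    · simp only [dif_pos h, Pi.add_apply, Pi.smul_apply, RingHom.id_apply]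
    · simp only [dif_neg h, Pi.add_apply, Pi.smul_apply, RingHom.id_apply, add_zero, smul_zero]
  map_smul' c a := by
    ext j
    by_cases h : (j : ℕ) < r / 2 + 1
    · simp only [dif_pos h, Pi.add_apply, Pi.smul_apply, RingHom.id_apply]
    · simp only [dif_neg h, Pi.add_apply, Pi.smul_apply, RingHom.id_apply, add_zero, smul_zero]

lemma extz_apply (r : ℕ) (δ) (j) :
    extz r δ j = if h : (j : ℕ) < r / 2 + 1 then δ ⟨j, h⟩ else 0 := rfl

lemma finrank_K (r : ℕ) : Module.finrank ℝ (K r) = r / 2 + 1 := by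
  obtain ⟨M, d, hM, hu, hd, h⟩ := exists_ldl (Gm r) (Gm_posDef r)
  let Φ : (Fin (r / 2 + 1) → ℝ) →ₗ[ℝ] R3 :=
    (toP r).comp ((LinearMap.mulRight ℝ M).comp ((LinearMap.mulLeft ℝ M.transpose).comp
      ((Matrix.diagonalLinearMap (Fin (r+1)) ℝ ℝ).comp (extz r))))
  have hΦ : ∀ δ, Φ δ = toP r (M.transpose * Matrix.diagonal (extz r δ) * M) := fun δ => rfl
  have hut : IsUnit M.transpose.det := by rwa [Matrix.det_transpose]
  have hz : ∀ δ, ∀ j : Fin (r+1), r < 2 * (j : ℕ) → extz r δ j = 0 := by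
    intro δ j hj
    rw [extz_apply, dif_neg (by omega)]
  have hinj : Function.Injective Φ := by
    intro a b hab
    rw [hΦ, hΦ] at hab
    have h1 := toP_inj r hab
    have h2 := ((Matrix.isUnit_iff_isUnit_det _).2 hu).mul_right_cancel h1
    have h3 := ((Matrix.isUnit_iff_isUnit_det _).2 hut).mul_left_cancel h2
    have h4 := Matrix.diagonal_injective h3
    ext j
    have h5 := congrFun h4 ⟨j, by omega⟩
    rw [extz_apply, extz_apply, dif_pos j.2, dif_pos j.2] at h5
    exact h5
  have hr : LinearMap.range Φ = K r := by
    ext F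
    constructor
    · rintro ⟨δ, rfl⟩
      rw [hΦ, mem_K_toP r _ ((anti hM hu _).2 (hz δ)), key hM hu hd h]
      exact ⟨_, rfl⟩
    · intro hF
      obtain ⟨A, hA, rfl⟩ := exists_toP r F hF.1
      rw [mem_K_toP r A hA, key hM hu hd h] at hF
      obtain ⟨δ, rfl⟩ := hF
      rw [anti hM hu] at hA
      refine ⟨fun j => δ ⟨j, by omega⟩, ?_⟩
      rw [hΦ]
      congr 4
      ext j
      rw [extz_apply]
      split_ifs with hj
      · rfl
      · exact (hA j (by omega)).symm
  rw [← hr, LinearMap.finrank_range_of_inj hinj]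
  simp

/-- Main Theorem: for every `n ≥ 1`, `dim_ℝ K(2n−1) = n` and `dim_ℝ K(2n) = n + 1`;
equivalently, `dim_ℝ K(r) = ⌊r/2⌋ + 1` for every `r ≥ 1`. -/
theorem main_theorem (n : ℕ) (hn : 1 ≤ n) :
    Module.finrank ℝ (K (2 * n - 1)) = n ∧ Module.finrank ℝ (K (2 * n)) = n + 1 := by
  refine ⟨?_, ?_⟩
  · rw [finrank_K]; omega
  · rw [finrank_K]; omega

end
end

section
/- (Vanishing of the local cohomology Hilbert function for the Schenck–Stiller triangulation) For every integer r ≥ 1, every homogeneous polynomial F ∈ R of degree r belongs to the ideal sum (J₁(r) : ⟨y^{r+1}⟩) + (J₂(r) : ⟨y^{r+1}⟩); equivalently, the Hilbert function of R/((J₁(r):⟨y^{r+1}⟩) + (J₂(r):⟨y^{r+1}⟩)) vanishes in degree r. -/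
open MvPolynomial

noncomputable section

/-- The Beta-type coefficients. -/
def cf (p q : ℕ) : ℝ := ∫ u in (0:ℝ)..1, u ^ p * (1 - u) ^ q

lemma cf_pos (p q : ℕ) : 0 < cf p q := by
  unfold cf
  apply intervalIntegral.intervalIntegral_pos_of_pos_on
  · exact (by fun_prop : Continuous fun u : ℝ => u ^ p * (1 - u) ^ q).intervalIntegrable _ _
  · intro u hu
    have h1 : 0 < u := hu.1
    have h2 : 0 < 1 - u := by linarith [hu.2]
    positivity
  · norm_num

lemma half_id (m i : ℕ) (a b : ℝ) :
    (∫ v in (0:ℝ)..b, (v - a) ^ m * (b - v) ^ m * v ^ i) =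
      b ^ (m + i + 1) * ∑ s ∈ Finset.range (m + 1),
        (m.choose s : ℝ) * cf (s + i) m * b ^ s * (-a) ^ (m - s) := by
  have h := intervalIntegral.mul_integral_comp_mul_add (a := 0) (b := 1)
    (f := fun v : ℝ => (v - a) ^ m * (b - v) ^ m * v ^ i) b 0
  simp only [mul_zero, mul_one, add_zero] at h
  rw [← h]
  have h2 : ∀ u : ℝ, (b * u - a) ^ m * (b - b * u) ^ m * (b * u) ^ i =
      ∑ s ∈ Finset.range (m + 1), ((m.choose s : ℝ) * b ^ (m + i) * b ^ s * (-a) ^ (m - s)) *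
        (u ^ (s + i) * (1 - u) ^ m) := by
    intro u
    rw [sub_eq_add_neg (b * u) a, add_pow, Finset.sum_mul, Finset.sum_mul]
    refine Finset.sum_congr rfl fun s _ => ?_
    rw [show b - b * u = b * (1 - u) by ring]
    simp only [mul_pow]
    ring
  simp_rw [h2]
  rw [intervalIntegral.integral_finsetSum]
  · simp_rw [intervalIntegral.integral_const_mul]
    rw [Finset.mul_sum, Finset.mul_sum]
    refine Finset.sum_congr rfl fun s _ => ?_
    unfold cf
    ring
  · intro s _
    exact Continuous.intervalIntegrable (by fun_prop) _ _

lemma full_id (m i : ℕ) (a y : ℝ) :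
    (∫ v in a..(a + y), (v - a) ^ m * (a + y - v) ^ m * v ^ i) =
      y ^ (2 * m + 1) * ∑ s ∈ Finset.range (i + 1),
        (i.choose s : ℝ) * cf (m + s) m * y ^ s * a ^ (i - s) := by
  have h := intervalIntegral.mul_integral_comp_mul_add (a := 0) (b := 1)
    (f := fun v : ℝ => (v - a) ^ m * (a + y - v) ^ m * v ^ i) y a
  simp only [mul_zero, mul_one, zero_add] at h
  rw [add_comm y a] at h
  rw [← h]
  have h2 : ∀ u : ℝ, (y * u + a - a) ^ m * (a + y - (y * u + a)) ^ m * (y * u + a) ^ i =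
      ∑ s ∈ Finset.range (i + 1), ((i.choose s : ℝ) * y ^ (2 * m) * y ^ s * a ^ (i - s)) *
        (u ^ (m + s) * (1 - u) ^ m) := by
    intro u
    rw [add_pow, Finset.mul_sum]
    refine Finset.sum_congr rfl fun s _ => ?_
    rw [show a + y - (y * u + a) = y * (1 - u) by ring, show y * u + a - a = y * u by ring]
    simp only [mul_pow]
    ring
  simp_rw [h2]
  rw [intervalIntegral.integral_finsetSum]
  · simp_rw [intervalIntegral.integral_const_mul]
    rw [Finset.mul_sum, Finset.mul_sum]
    refine Finset.sum_congr rfl fun s _ => ?_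
    unfold cf
    ring
  · intro s _
    exact Continuous.intervalIntegrable (by fun_prop) _ _

lemma real_id (m i : ℕ) (a y : ℝ) :
    y ^ (2 * m + 1) * ∑ s ∈ Finset.range (i + 1),
        (i.choose s : ℝ) * cf (m + s) m * y ^ s * a ^ (i - s) =
      (a + y) ^ (m + i + 1) * ∑ s ∈ Finset.range (m + 1),
        (m.choose s : ℝ) * cf (s + i) m * (a + y) ^ s * (-a) ^ (m - s) -
      a ^ (m + i + 1) * ∑ s ∈ Finset.range (m + 1),
        (m.choose s : ℝ) * cf (s + i) m * a ^ s * (-(a + y)) ^ (m - s) := by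
  rw [← full_id, ← half_id, ← half_id]
  have : ∀ v : ℝ, (v - (a + y)) ^ m * (a - v) ^ m * v ^ i =
      (v - a) ^ m * (a + y - v) ^ m * v ^ i := by
    intro v
    rw [← mul_pow, ← mul_pow]
    congr 2
    ring
  simp_rw [this]
  rw [intervalIntegral.integral_interval_sub_left]
  · exact Continuous.intervalIntegrable (by fun_prop) _ _
  · exact Continuous.intervalIntegrable (by fun_prop) _ _

/-- The form of degree `i` in `w, y`. -/
def ee (w : R3) (m i : ℕ) : R3 := ∑ s ∈ Finset.range (i + 1),
        C ((i.choose s : ℝ) * cf (m + s) m) * X 1 ^ s * w ^ (i - s)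

lemma ee_mem (p : Fin 3) (m i : ℕ) :
    (X 1 : R3) ^ (2 * m + 1) * ee (X p) m i ∈
      Ideal.span {(X p : R3) ^ (m + i + 1), ((X p : R3) + X 1) ^ (m + i + 1)} := by
  have : (X 1 : R3) ^ (2 * m + 1) * ee (X p) m i =
      (X p + X 1 : R3) ^ (m + i + 1) * ∑ s ∈ Finset.range (m + 1),
        C ((m.choose s : ℝ) * cf (s + i) m) * (X p + X 1) ^ s * (-X p) ^ (m - s) -
      X p ^ (m + i + 1) * ∑ s ∈ Finset.range (m + 1),
        C ((m.choose s : ℝ) * cf (s + i) m) * X p ^ s * (-(X p + X 1)) ^ (m - s) := by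
    apply MvPolynomial.funext
    intro f
    simp only [ee, map_mul, map_sub, map_sum, map_pow, map_add, map_neg, eval_X, eval_C]
    simpa only [map_mul] using real_id m i (f p) (f 1)
  rw [this]
  apply Ideal.sub_mem
  · exact Ideal.mul_mem_right _ _ (Ideal.subset_span (by simp))
  · exact Ideal.mul_mem_right _ _ (Ideal.subset_span (by simp))

lemma step (T : Ideal R3) (p : Fin 3) (m i j : ℕ) (g : R3)
    (he : ee (X p) m i * X 1 ^ j * g ∈ T)
    (ih : ∀ s, 1 ≤ s → s ≤ i → (X p : R3) ^ (i - s) * X 1 ^ (j + s) * g ∈ T) :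
    (X p : R3) ^ i * X 1 ^ j * g ∈ T := by
  have hc := (cf_pos m m).ne'
  rw [ee, Finset.sum_range_succ', add_mul, add_mul] at he
  have h1 : (∑ s ∈ Finset.range i, C ((i.choose (s + 1) : ℝ) * cf (m + (s + 1)) m) *
      X 1 ^ (s + 1) * (X p : R3) ^ (i - (s + 1))) * X 1 ^ j * g ∈ T := by
    rw [Finset.sum_mul, Finset.sum_mul]
    refine Ideal.sum_mem _ fun s hs => ?_
    have := ih (s + 1) (by omega) (by have := Finset.mem_range.1 hs; omega)
    convert T.mul_mem_left (C ((i.choose (s + 1) : ℝ) * cf (m + (s + 1)) m)) this using 1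
    ring
  have h2 := (Ideal.add_mem_iff_right T h1).1 he
  have h3 := T.mul_mem_left (C (cf m m)⁻¹) h2
  have h4 : (C (cf m m)⁻¹ * C (cf m m) : R3) = 1 := by
    rw [← C_mul, inv_mul_cancel₀ hc, C_1]
  convert h3 using 1
  simp only [Nat.choose_zero_right, Nat.cast_one, one_mul, add_zero, pow_zero, mul_one,
    Nat.sub_zero]
  linear_combination (-(X p : R3) ^ i * X 1 ^ j * g) * h4

lemma mem_col (p : Fin 3) (r i j : ℕ) (hi : i ≤ r) (hj : r ≤ 2 * i + j) :
    (ee (X p) (r - i) i * X 1 ^ j) ∈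
      (Ideal.span {(X p : R3) ^ (r + 1), ((X p : R3) + X 1) ^ (r + 1)}).colon
        (Ideal.span {(X 1 : R3) ^ (r + 1)}) := by
  have h := ee_mem p (r - i) i
  rw [show r - i + i + 1 = r + 1 by omega] at h
  rw [Submodule.mem_colon]
  intro q hq
  obtain ⟨t, rfl⟩ := Ideal.mem_span_singleton'.1 hq
  obtain ⟨k, hk⟩ : ∃ k, r + 1 + j = 2 * (r - i) + 1 + k :=
    ⟨r + 1 + j - (2 * (r - i) + 1), by omega⟩
  have hp : (X 1 : R3) ^ (r + 1) * X 1 ^ j = X 1 ^ (2 * (r - i) + 1) * X 1 ^ k := by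
    rw [← pow_add, ← pow_add, hk]
  convert Ideal.mul_mem_left _ (t * X 1 ^ k) h using 1
  rw [smul_eq_mul]
  linear_combination (t * ee (X p) (r - i) i) * hp

lemma mono_mem (r : ℕ) : ∀ n i j k : ℕ, i + k = n → i + j + k = r →
    (X 0 : R3) ^ i * X 1 ^ j * X 2 ^ k ∈ (J1 r).colon (Ideal.span {(X 1 : R3) ^ (r + 1)}) +
        (J2 r).colon (Ideal.span {(X 1 : R3) ^ (r + 1)}) := by
  intro n
  induction n using Nat.strong_induction_on with
  | _ n ih =>
  intro i j k hn hr
  rcases le_total k i with hik | hik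
  · apply step _ 0 (r - i) i j
    · exact Ideal.mul_mem_right _ _ (Ideal.mem_sup_left (mem_col 0 r i j (by omega) (by omega)))
    · intro s h1 h2
      exact ih (i - s + k) (by omega) _ _ _ rfl (by omega)
  · have := step ((J1 r).colon (Ideal.span {(X 1 : R3) ^ (r + 1)}) +
        (J2 r).colon (Ideal.span {(X 1 : R3) ^ (r + 1)})) 2 (r - k) k j (X 0 ^ i) ?_ ?_
    · convert this using 1
      ring
    · exact Ideal.mul_mem_right _ _ (Ideal.mem_sup_right (mem_col 2 r k j (by omega) (by omega)))
    · intro s h1 h2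
      convert ih (i + (k - s)) (by omega) i (j + s) (k - s) rfl (by omega) using 1
      ring

theorem hilbert_function_vanishing (r : ℕ) (hr : 1 ≤ r) (F : R3)
    (hF : F.IsHomogeneous r) :
    F ∈ (J1 r).colon (Ideal.span {(X 1 : R3) ^ (r + 1)}) +
        (J2 r).colon (Ideal.span {(X 1 : R3) ^ (r + 1)}) := by
  rw [F.as_sum]
  refine Ideal.sum_mem _ fun d hd => ?_
  have hdeg := hF (mem_support_iff.1 hd)
  rw [Finsupp.weight_apply, Finsupp.sum_fintype _ _ (by simp)] at hdeg
  simp [Fin.sum_univ_three] at hdeg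
  rw [monomial_eq, Finsupp.prod_fintype _ _ (by simp), Fin.prod_univ_three]
  exact Ideal.mul_mem_left _ _ (mono_mem r _ (d 0) (d 1) (d 2) rfl hdeg)

end
end
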